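/- Let K and L be non-degenerate even lattices. There exist an even unimodular lattice Γ and a primitive embedding of K into Γ whose orthogonal complement K^⊥ in Γ is isomorphic (as a lattice) to L, if and only if there exists a group isomorphism A(K) ≅ A(L) under which q(K) corresponds to −q(L). -/

import Mathlib

/-- The dual lattice `L^∨ = {x ∈ L ⊗ ℚ | ⟨x,y⟩ ∈ ℤ for all y ∈ L}` of a full lattice
`L` in the ambient rational vector space `V = L ⊗ ℚ`. -/
def dualLattice {V : Type*} [AddCommGroup V] [Module ℚ V]
    (Φ : V →ₗ[ℚ] V →ₗ[ℚ] ℚ) (L : Submodule ℤ V) : Submodule ℤ V where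
  carrier := {x | ∀ y ∈ L, ∃ n : ℤ, Φ x y = (n : ℚ)}
  add_mem' := by
    intro a b ha hb y hy
    obtain ⟨n, hn⟩ := ha y hy
    obtain ⟨m, hm⟩ := hb y hy
    exact ⟨n + m, by rw [map_add, LinearMap.add_apply, hn, hm]; push_cast; ring⟩
  zero_mem' := by
    intro y hy
    exact ⟨0, by simp⟩
  smul_mem' := by
    intro c x hx y hy
    obtain ⟨n, hn⟩ := hx y hy
    refine ⟨c * n, ?_⟩
    rw [← Int.cast_smul_eq_zsmul ℚ c x, map_smul, LinearMap.smul_apply, hn, smul_eq_mul]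
    push_cast; ring

/-- The discriminant group `A(L) = L^∨/L` of a full lattice `L`. -/
abbrev discGroup {V : Type*} [AddCommGroup V] [Module ℚ V]
    (Φ : V →ₗ[ℚ] V →ₗ[ℚ] ℚ) (L : Submodule ℤ V) : Type _ :=
  ↥(dualLattice Φ L) ⧸ Submodule.comap (dualLattice Φ L).subtype L

/-- The orthogonal complement `M^⊥ = {x ∈ G | ⟨x,y⟩ = 0 for all y ∈ M}` of `M` in `G`. -/
def perpIn {V : Type*} [AddCommGroup V] [Module ℚ V]
    (Φ : V →ₗ[ℚ] V →ₗ[ℚ] ℚ) (G M : Submodule ℤ V) : Submodule ℤ V where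
  carrier := {x | x ∈ G ∧ ∀ y ∈ M, Φ x y = 0}
  add_mem' := by
    rintro a b ⟨haL, ha⟩ ⟨hbL, hb⟩
    exact ⟨G.add_mem haL hbL, fun y hy => by
      rw [map_add, LinearMap.add_apply, ha y hy, hb y hy, add_zero]⟩
  zero_mem' := ⟨G.zero_mem, fun y hy => by simp⟩
  smul_mem' := by
    rintro c x ⟨hxL, hx⟩
    refine ⟨G.smul_mem c hxL, fun y hy => ?_⟩
    rw [← Int.cast_smul_eq_zsmul ℚ c x, map_smul, LinearMap.smul_apply, hx y hy, smul_zero]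


lemma aux_basis {V : Type*} [AddCommGroup V] [Module ℚ V] (L : Submodule ℤ V) (hfg : L.FG)
    (hspan : Submodule.span ℚ (L : Set V) = ⊤) :
    ∃ (n : ℕ) (b : Module.Basis (Fin n) ℚ V), Submodule.span ℤ (Set.range b) = L := by
  have : Module.Finite ℤ L := Module.Finite.iff_fg.mpr hfg
  have : Module.IsTorsionFree ℤ V := Module.IsTorsionFree.trans ℚ
  have : Module.Free ℤ L := inferInstance
  let c := Module.finBasis ℤ L
  have hs : Submodule.span ℤ (Set.range fun i => (c i : V)) = L := by
    have := congrArg (Submodule.map L.subtype) c.span_eq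
    rw [Submodule.map_span, ← Set.range_comp, Submodule.map_top, Submodule.range_subtype] at this
    exact this
  have hli : LinearIndependent ℤ (fun i => (c i : V)) :=
    c.linearIndependent.map' L.subtype (Submodule.ker_subtype L)
  rw [LinearIndependent.iff_fractionRing ℤ ℚ] at hli
  refine ⟨_, Module.Basis.mk hli ?_, ?_⟩
  · rw [← hspan, Submodule.span_le]
    intro x hx
    have hx' : x ∈ L := hx
    rw [← hs] at hx'
    exact Submodule.span_subset_span ℤ ℚ _ hx'
  · rw [Module.Basis.coe_mk, hs]

lemma aux_dual_eq {V : Type*} [AddCommGroup V] [Module ℚ V]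
    (Φ : V →ₗ[ℚ] V →ₗ[ℚ] ℚ) (L : Submodule ℤ V) :
    dualLattice Φ L = LinearMap.BilinForm.dualSubmodule Φ L := by
  ext x
  rw [LinearMap.BilinForm.mem_dualSubmodule]
  refine forall₂_congr fun y hy => ?_
  rw [Submodule.mem_one]
  simp [eq_comm]

lemma aux_dual {V : Type*} [AddCommGroup V] [Module ℚ V] [FiniteDimensional ℚ V]
    (Φ : V →ₗ[ℚ] V →ₗ[ℚ] ℚ) (hs : ∀ x y, Φ x y = Φ y x)
    (hnd : ∀ x, (∀ y, Φ x y = 0) → x = 0)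
    (L : Submodule ℤ V) (hfg : L.FG)
    (hspan : Submodule.span ℚ (L : Set V) = ⊤) :
    (dualLattice Φ L).FG ∧ dualLattice Φ (dualLattice Φ L) = L := by
  obtain ⟨n, b, rfl⟩ := aux_basis L hfg hspan
  have hN : LinearMap.BilinForm.Nondegenerate Φ := by
    refine ⟨fun x hx => hnd x hx, fun x hx => hnd x fun y => by rw [hs]; exact hx y⟩
  simp only [aux_dual_eq]
  constructor
  · rw [LinearMap.BilinForm.dualSubmodule_span_of_basis Φ hN]
    exact Submodule.fg_span (Set.finite_range _)
  · exact LinearMap.BilinForm.dualSubmodule_dualSubmodule_of_basis Φ hN ⟨fun x y => by simpa using hs x y⟩ b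

lemma aux_equiv {G A B : Type*} [AddCommGroup G] [AddCommGroup A] [AddCommGroup B]
    (g : G →+ A) (h : G →+ B) (hg : Function.Surjective g) (hh : Function.Surjective h)
    (hk : ∀ x, g x = 0 ↔ h x = 0) : ∃ f : A ≃+ B, ∀ x, f (g x) = h x := by
  have hk' : g.ker = h.ker := by ext x; exact hk x
  refine ⟨(QuotientAddGroup.quotientKerEquivOfSurjective g hg).symm.trans
    ((QuotientAddGroup.quotientAddEquivOfEq hk').trans
      (QuotientAddGroup.quotientKerEquivOfSurjective h hh)), fun x => ?_⟩
  have : (QuotientAddGroup.quotientKerEquivOfSurjective g hg).symm (g x) = (x : G ⧸ g.ker) := by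
    rw [AddEquiv.symm_apply_eq]; rfl
  simp only [AddEquiv.trans_apply, this]
  rfl

/-- orthogonal sum of forms -/
noncomputable def auxForm {VK VL : Type*} [AddCommGroup VK] [Module ℚ VK]
    [AddCommGroup VL] [Module ℚ VL]
    (ΦK : VK →ₗ[ℚ] VK →ₗ[ℚ] ℚ) (ΦL : VL →ₗ[ℚ] VL →ₗ[ℚ] ℚ) :
    (VK × VL) →ₗ[ℚ] (VK × VL) →ₗ[ℚ] ℚ :=
  ΦK.compl₁₂ (LinearMap.fst ℚ VK VL) (LinearMap.fst ℚ VK VL) +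
  ΦL.compl₁₂ (LinearMap.snd ℚ VK VL) (LinearMap.snd ℚ VK VL)

lemma auxForm_apply {VK VL : Type*} [AddCommGroup VK] [Module ℚ VK]
    [AddCommGroup VL] [Module ℚ VL]
    (ΦK : VK →ₗ[ℚ] VK →ₗ[ℚ] ℚ) (ΦL : VL →ₗ[ℚ] VL →ₗ[ℚ] ℚ) (x y : VK × VL) :
    auxForm ΦK ΦL x y = ΦK x.1 y.1 + ΦL x.2 y.2 := rfl

/-- surjectivity of the projection of a self-dual lattice -/
lemma aux_proj {V W : Type*} [AddCommGroup V] [Module ℚ V] [FiniteDimensional ℚ V]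
    [AddCommGroup W] [Module ℚ W] 
    (Φ : V →ₗ[ℚ] V →ₗ[ℚ] ℚ) (Ψ : W →ₗ[ℚ] W →ₗ[ℚ] ℚ) (hs : ∀ x y, Φ x y = Φ y x)
    (hnd : ∀ x, (∀ y, Φ x y = 0) → x = 0)
    (K : Submodule ℤ V) (hspan : Submodule.span ℚ (K : Set V) = ⊤)
    (G : Submodule ℤ W) (hfg : G.FG) (hdual : dualLattice Ψ G = G)
    (p : W →ₗ[ℚ] V) (i : V →ₗ[ℚ] W)
    (hpi : ∀ x, p (i x) = x)
    (hadj : ∀ x y, Ψ (i x) y = Φ x (p y))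
    (hK : ∀ x, i x ∈ G ↔ x ∈ K) :
    G.map (p.restrictScalars ℤ) = dualLattice Φ K := by
  have h1 : dualLattice Φ (G.map (p.restrictScalars ℤ)) = K := by
    ext x
    have hd : i x ∈ dualLattice Ψ G ↔ i x ∈ G := by rw [hdual]
    rw [← hK, ← hd]
    constructor
    · intro h y hy
      rw [hadj]
      exact h _ ⟨y, hy, rfl⟩
    · rintro h _ ⟨y, hy, rfl⟩
      have := h y hy
      rwa [hadj] at this
  have h2 : (G.map (p.restrictScalars ℤ)).FG := hfg.map _
  have h3 : Submodule.span ℚ (G.map (p.restrictScalars ℤ) : Set V) = ⊤ := by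
    rw [eq_top_iff, ← hspan]
    apply Submodule.span_mono
    intro x hx
    exact ⟨i x, (hK x).2 hx, hpi x⟩
  have := (aux_dual Φ hs hnd _ h2 h3).2
  rw [h1] at this
  exact this.symm

lemma aux_forward {VK VL : Type*} [AddCommGroup VK] [Module ℚ VK] [FiniteDimensional ℚ VK]
    [AddCommGroup VL] [Module ℚ VL] [FiniteDimensional ℚ VL]
    (ΦK : VK →ₗ[ℚ] VK →ₗ[ℚ] ℚ) (ΦL : VL →ₗ[ℚ] VL →ₗ[ℚ] ℚ)
    (hsymmK : ∀ x y, ΦK x y = ΦK y x) (hsymmL : ∀ x y, ΦL x y = ΦL y x)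
    (hndK : ∀ x : VK, (∀ y, ΦK x y = 0) → x = 0)
    (hndL : ∀ x : VL, (∀ y, ΦL x y = 0) → x = 0)
    (K : Submodule ℤ VK) 
    (hspanK : Submodule.span ℚ (K : Set VK) = ⊤)
    (L : Submodule ℤ VL)
    (hspanL : Submodule.span ℚ (L : Set VL) = ⊤)
    (G : Submodule ℤ (VK × VL)) (hfg : G.FG)
    (heven : ∀ x ∈ G, ∃ n : ℤ, auxForm ΦK ΦL x x = 2 * (n : ℚ))
    (hdual : dualLattice (auxForm ΦK ΦL) G = G)
    (hGK : ∀ x, (x, (0 : VL)) ∈ G ↔ x ∈ K)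
    (hGL : ∀ x, ((0 : VK), x) ∈ G ↔ x ∈ L) :
    (∃ f : discGroup ΦK K ≃+ discGroup ΦL L,
      ∀ (x : ↥(dualLattice ΦK K)) (y : ↥(dualLattice ΦL L)),
        f (Submodule.Quotient.mk x) = Submodule.Quotient.mk y →
        ∃ n : ℤ, ΦL (y : VL) (y : VL) + ΦK (x : VK) (x : VK) = 2 * (n : ℚ)) := by
  have hp1 := aux_proj ΦK (auxForm ΦK ΦL) hsymmK hndK K hspanK G hfg hdual
    (LinearMap.fst ℚ VK VL) (LinearMap.inl ℚ VK VL) (fun x => rfl)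
    (fun x y => by simp [auxForm_apply]) (fun x => hGK x)
  have hp2 := aux_proj ΦL (auxForm ΦK ΦL) hsymmL hndL L hspanL G hfg hdual
    (LinearMap.snd ℚ VK VL) (LinearMap.inr ℚ VK VL) (fun x => rfl)
    (fun x y => by simp [auxForm_apply]) (fun x => hGL x)
  have m1 : ∀ z : G, (z : VK × VL).1 ∈ dualLattice ΦK K := fun z => by
    rw [← hp1]; exact ⟨z, z.2, rfl⟩
  have m2 : ∀ z : G, (z : VK × VL).2 ∈ dualLattice ΦL L := fun z => by
    rw [← hp2]; exact ⟨z, z.2, rfl⟩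
  let g : G →+ discGroup ΦK K :=
    { toFun := fun z => Submodule.Quotient.mk ⟨_, m1 z⟩
      map_zero' := rfl
      map_add' := fun _ _ => rfl }
  let h : G →+ discGroup ΦL L :=
    { toFun := fun z => Submodule.Quotient.mk ⟨_, m2 z⟩
      map_zero' := rfl
      map_add' := fun _ _ => rfl }
  have sg : ∀ x : dualLattice ΦK K, ∃ z : G, (z : VK × VL).1 = x := by
    rintro ⟨x, hx⟩
    rw [← hp1] at hx
    obtain ⟨z, hz, rfl⟩ := hx
    exact ⟨⟨z, hz⟩, rfl⟩
  have sh : ∀ x : dualLattice ΦL L, ∃ z : G, (z : VK × VL).2 = x := by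
    rintro ⟨x, hx⟩
    rw [← hp2] at hx
    obtain ⟨z, hz, rfl⟩ := hx
    exact ⟨⟨z, hz⟩, rfl⟩
  have hg : Function.Surjective g := by
    intro a
    obtain ⟨x, rfl⟩ := Submodule.Quotient.mk_surjective _ a
    obtain ⟨z, hz⟩ := sg x
    exact ⟨z, congrArg Submodule.Quotient.mk (Subtype.ext hz)⟩
  have hh : Function.Surjective h := by
    intro a
    obtain ⟨x, rfl⟩ := Submodule.Quotient.mk_surjective _ a
    obtain ⟨z, hz⟩ := sh x
    exact ⟨z, congrArg Submodule.Quotient.mk (Subtype.ext hz)⟩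
  have hk : ∀ x, g x = 0 ↔ h x = 0 := by
    intro z
    have e1 : g z = 0 ↔ (z : VK × VL).1 ∈ K := Submodule.Quotient.mk_eq_zero _
    have e2 : h z = 0 ↔ (z : VK × VL).2 ∈ L := Submodule.Quotient.mk_eq_zero _
    rw [e1, e2, ← hGK, ← hGL]
    have hz : (z : VK × VL) = ((z : VK × VL).1, (0 : VL)) + ((0 : VK), (z : VK × VL).2) := by
      simp
    have := z.2
    rw [hz] at this
    constructor
    · intro h; exact (G.add_mem_iff_right h).1 this
    · intro h; exact (G.add_mem_iff_left h).1 this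
  obtain ⟨f, hf⟩ := aux_equiv g h hg hh hk
  refine ⟨f, fun x y hxy => ?_⟩
  obtain ⟨z, hz⟩ := sg x
  have e : (Submodule.Quotient.mk x : discGroup ΦK K) = g z :=
    congrArg Submodule.Quotient.mk (Subtype.ext hz.symm)
  rw [e, hf] at hxy
  have hmem : (z : VK × VL).2 - y ∈ L :=
    (Submodule.Quotient.eq (Submodule.comap (dualLattice ΦL L).subtype L)).1 hxy
  have hG : ((x : VK), (y : VL)) ∈ G := by
    have := G.sub_mem z.2 ((hGL _).2 hmem)
    have e : (z : VK × VL) - (0, (z : VK × VL).2 - y) = ((x : VK), (y : VL)) := by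
      ext
      · simp [hz]
      · simp
    rwa [e] at this
  obtain ⟨n, hn⟩ := heven _ hG
  exact ⟨n, by rw [← hn, auxForm_apply, add_comm]⟩

/-- the glued lattice -/
def auxGlue {VK VL : Type*} [AddCommGroup VK] [Module ℚ VK]
    [AddCommGroup VL] [Module ℚ VL]
    (ΦK : VK →ₗ[ℚ] VK →ₗ[ℚ] ℚ) (ΦL : VL →ₗ[ℚ] VL →ₗ[ℚ] ℚ)
    (K : Submodule ℤ VK) (L : Submodule ℤ VL)
    (f : discGroup ΦK K ≃+ discGroup ΦL L) : Submodule ℤ (VK × VL) where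
  carrier := {z | ∃ (a : dualLattice ΦK K) (b : dualLattice ΦL L),
    f (Submodule.Quotient.mk a) = Submodule.Quotient.mk b ∧ z = ((a : VK), (b : VL))}
  add_mem' := by
    rintro _ _ ⟨a, b, h, rfl⟩ ⟨a', b', h', rfl⟩
    exact ⟨a + a', b + b', by rw [Submodule.Quotient.mk_add, map_add, h, h']; rfl, rfl⟩
  zero_mem' := ⟨0, 0, by rw [Submodule.Quotient.mk_zero, map_zero]; rfl, rfl⟩
  smul_mem' := by
    rintro c _ ⟨a, b, h, rfl⟩
    exact ⟨c • a, c • b, by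
      rw [Submodule.Quotient.mk_smul, map_zsmul, h]; rfl, rfl⟩

lemma aux_extend {V W : Type*} [AddCommGroup V] [Module ℚ V] [AddCommGroup W] [Module ℚ W]
    (L : Submodule ℤ V) (hfg : L.FG)
    (hspan : Submodule.span ℚ (L : Set V) = ⊤) (u : L →+ W) :
    ∃ i : V →ₗ[ℚ] W, ∀ x : L, i x = u x := by
  obtain ⟨n, b, rfl⟩ := aux_basis L hfg hspan
  let i : V →ₗ[ℚ] W := b.constr ℚ (fun k => u ⟨b k, Submodule.subset_span ⟨k, rfl⟩⟩)
  refine ⟨i, ?_⟩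
  rintro ⟨x, hx⟩
  induction hx using Submodule.span_induction with
  | mem x h =>
    obtain ⟨k, rfl⟩ := h
    exact b.constr_basis ℚ _ k
  | zero => exact (map_zero i).trans (map_zero u).symm
  | add x y hx hy h1 h2 =>
    have : u ⟨x + y, Submodule.add_mem _ hx hy⟩ = u ⟨x, hx⟩ + u ⟨y, hy⟩ := u.map_add ⟨x, hx⟩ ⟨y, hy⟩
    rw [this, ← h1, ← h2]
    exact map_add i x y
  | smul c x hx h =>
    have : u ⟨c • x, Submodule.smul_mem _ c hx⟩ = c • u ⟨x, hx⟩ := map_zsmul u c ⟨x, hx⟩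
    rw [this, ← h]
    exact map_zsmul i c x

lemma aux_ext {V W : Type*} [AddCommGroup V] [Module ℚ V] [AddCommGroup W] [Module ℚ W]
    (A B : V →ₗ[ℚ] W →ₗ[ℚ] ℚ) (S : Set V) (T : Set W) (hS : Submodule.span ℚ S = ⊤)
    (hT : Submodule.span ℚ T = ⊤) (h : ∀ x ∈ S, ∀ y ∈ T, A x y = B x y) : A = B :=
  LinearMap.ext_on hS fun x hx => LinearMap.ext_on hT fun y hy => h x hx y hy

lemma aux_clear {V : Type*} [AddCommGroup V] [Module ℚ V] (L : Submodule ℤ V)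
    (hspan : Submodule.span ℚ (L : Set V) = ⊤) (x : V) : ∃ n : ℤ, n ≠ 0 ∧ n • x ∈ L := by
  have hx : x ∈ Submodule.span ℚ (L : Set V) := by rw [hspan]; trivial
  induction hx using Submodule.span_induction with
  | mem x h => exact ⟨1, one_ne_zero, by simpa using h⟩
  | zero => exact ⟨1, one_ne_zero, by simp⟩
  | add x y _ _ h1 h2 =>
    obtain ⟨n, hn, h1⟩ := h1
    obtain ⟨m, hm, h2⟩ := h2
    refine ⟨n * m, mul_ne_zero hn hm, ?_⟩
    rw [smul_add]
    refine L.add_mem ?_ ?_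
    · rw [mul_comm, mul_smul]; exact L.smul_mem _ h1
    · rw [mul_smul]; exact L.smul_mem _ h2
  | smul c x _ h =>
    obtain ⟨n, hn, h⟩ := h
    refine ⟨c.den * n, mul_ne_zero (by exact_mod_cast c.den_ne_zero) hn, ?_⟩
    have : ((c.den * n : ℤ)) • c • x = c.num • n • x := by
      simp only [← Int.cast_smul_eq_zsmul ℚ, smul_smul]
      congr 1
      push_cast
      have := Rat.den_mul_eq_num c
      linear_combination (n : ℚ) * this
    rw [this]
    exact L.smul_mem _ h

lemma aux_backward {VK VL : Type*} [AddCommGroup VK] [Module ℚ VK] [FiniteDimensional ℚ VK]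
    [AddCommGroup VL] [Module ℚ VL] [FiniteDimensional ℚ VL]
    (ΦK : VK →ₗ[ℚ] VK →ₗ[ℚ] ℚ) (ΦL : VL →ₗ[ℚ] VL →ₗ[ℚ] ℚ)
    (hsymmK : ∀ x y, ΦK x y = ΦK y x) (hsymmL : ∀ x y, ΦL x y = ΦL y x)
    (hndK : ∀ x : VK, (∀ y, ΦK x y = 0) → x = 0)
    (hndL : ∀ x : VL, (∀ y, ΦL x y = 0) → x = 0)
    (K : Submodule ℤ VK) (hfgK : K.FG)
    (hspanK : Submodule.span ℚ (K : Set VK) = ⊤)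
    (hintK : ∀ x ∈ K, ∀ y ∈ K, ∃ n : ℤ, ΦK x y = (n : ℚ))
    (L : Submodule ℤ VL) (hfgL : L.FG)
    (hspanL : Submodule.span ℚ (L : Set VL) = ⊤)
    (hintL : ∀ x ∈ L, ∀ y ∈ L, ∃ n : ℤ, ΦL x y = (n : ℚ))
    (f : discGroup ΦK K ≃+ discGroup ΦL L)
    (hf : ∀ (x : ↥(dualLattice ΦK K)) (y : ↥(dualLattice ΦL L)),
        f (Submodule.Quotient.mk x) = Submodule.Quotient.mk y →
        ∃ n : ℤ, ΦL (y : VL) (y : VL) + ΦK (x : VK) (x : VK) = 2 * (n : ℚ)) :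
    ∃ (ΦG : (VK × VL) →ₗ[ℚ] (VK × VL) →ₗ[ℚ] ℚ) (G : Submodule ℤ (VK × VL))
        (j : VK →ₗ[ℚ] VK × VL),
      (∀ x y, ΦG x y = ΦG y x) ∧ G.FG ∧
      Submodule.span ℚ (G : Set (VK × VL)) = ⊤ ∧
      (∀ x ∈ G, ∀ y ∈ G, ∃ n : ℤ, ΦG x y = (n : ℚ)) ∧
      (∀ x ∈ G, ∃ n : ℤ, ΦG x x = 2 * (n : ℚ)) ∧
      dualLattice ΦG G = G ∧
      Function.Injective j ∧
      (∀ x y : VK, ΦG (j x) (j y) = ΦK x y) ∧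
      K.map (j.restrictScalars ℤ) ≤ G ∧
      (∀ x ∈ G, ∀ n : ℤ, n ≠ 0 → n • x ∈ K.map (j.restrictScalars ℤ) →
        x ∈ K.map (j.restrictScalars ℤ)) ∧
      ∃ e : ↥(perpIn ΦG G (K.map (j.restrictScalars ℤ))) ≃+ ↥L,
        ∀ x y : ↥(perpIn ΦG G (K.map (j.restrictScalars ℤ))),
          ΦL (e x : VL) (e y : VL) = ΦG (x : VK × VL) (y : VK × VL) := by
  have hKd : K ≤ dualLattice ΦK K := fun x hx y hy => hintK x hx y hy
  have hLd : L ≤ dualLattice ΦL L := fun x hx y hy => hintL x hx y hy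
  obtain ⟨hdfK, -⟩ := aux_dual ΦK hsymmK hndK K hfgK hspanK
  obtain ⟨hdfL, hddL⟩ := aux_dual ΦL hsymmL hndL L hfgL hspanL
  set G := auxGlue ΦK ΦL K L f with hGdef
  have zK : ∀ a : dualLattice ΦK K, (Submodule.Quotient.mk a : discGroup ΦK K) = 0 ↔ (a : VK) ∈ K :=
    fun a => Submodule.Quotient.mk_eq_zero _
  have zL : ∀ a : dualLattice ΦL L, (Submodule.Quotient.mk a : discGroup ΦL L) = 0 ↔ (a : VL) ∈ L :=
    fun a => Submodule.Quotient.mk_eq_zero _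
  have hGK : ∀ x, (x, (0 : VL)) ∈ G ↔ x ∈ K := by
    intro x
    constructor
    · rintro ⟨a, b, h, hab⟩
      obtain ⟨rfl, hb⟩ := Prod.mk.inj hab
      rw [← zK, ← map_eq_zero_iff f f.injective, h, zL, ← hb]
      exact L.zero_mem
    · intro hx
      refine ⟨⟨x, hKd hx⟩, 0, ?_, rfl⟩
      rw [(zK ⟨x, hKd hx⟩).2 hx, map_zero]; rfl
  have hGL : ∀ x, ((0 : VK), x) ∈ G ↔ x ∈ L := by
    intro x
    constructor
    · rintro ⟨a, b, h, hab⟩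
      obtain ⟨ha, rfl⟩ := Prod.mk.inj hab
      rw [← zL, ← h, map_eq_zero_iff f f.injective, zK, ← ha]
      exact K.zero_mem
    · intro hx
      refine ⟨0, ⟨x, hLd hx⟩, ?_, rfl⟩
      rw [(zL ⟨x, hLd hx⟩).2 hx, Submodule.Quotient.mk_zero, map_zero]
  have heven : ∀ x ∈ G, ∃ n : ℤ, auxForm ΦK ΦL x x = 2 * (n : ℚ) := by
    rintro _ ⟨a, b, h, rfl⟩
    obtain ⟨n, hn⟩ := hf a b h
    exact ⟨n, by rw [← hn, auxForm_apply, add_comm]⟩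
  have hsymm : ∀ x y, auxForm ΦK ΦL x y = auxForm ΦK ΦL y x := by
    intro x y
    rw [auxForm_apply, auxForm_apply, hsymmK, hsymmL]
  have hint : ∀ x ∈ G, ∀ y ∈ G, ∃ n : ℤ, auxForm ΦK ΦL x y = (n : ℚ) := by
    intro x hx y hy
    obtain ⟨n, hn⟩ := heven x hx
    obtain ⟨m, hm⟩ := heven y hy
    obtain ⟨k, hk⟩ := heven _ (G.add_mem hx hy)
    refine ⟨k - n - m, ?_⟩
    simp only [map_add, LinearMap.add_apply] at hk
    rw [hsymm y x, hn, hm] at hk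
    push_cast
    linarith
  refine ⟨auxForm ΦK ΦL, G, LinearMap.inl ℚ VK VL, hsymm, ?_, ?_, hint, heven, ?_,
    LinearMap.inl_injective, ?_, ?_, ?_, ?_⟩
  · have hle : G ≤ (dualLattice ΦK K).prod (dualLattice ΦL L) := by
      rintro _ ⟨a, b, h, rfl⟩
      exact ⟨a.2, b.2⟩
    have : IsNoetherian ℤ ((dualLattice ΦK K).prod (dualLattice ΦL L)) :=
      isNoetherian_of_fg_of_noetherian _ (hdfK.prod hdfL)
    exact isNoetherian_submodule.1 this G hle
  · have h1 : ∀ x : VK, (x, (0 : VL)) ∈ Submodule.span ℚ (G : Set (VK × VL)) := by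
      intro x
      have : Submodule.span ℚ (K : Set VK) ≤
          (Submodule.span ℚ (G : Set (VK × VL))).comap (LinearMap.inl ℚ VK VL) := by
        rw [Submodule.span_le]
        intro y hy
        exact Submodule.subset_span ((hGK y).2 hy)
      rw [hspanK] at this
      exact this trivial
    have h2 : ∀ x : VL, ((0 : VK), x) ∈ Submodule.span ℚ (G : Set (VK × VL)) := by
      intro x
      have : Submodule.span ℚ (L : Set VL) ≤
          (Submodule.span ℚ (G : Set (VK × VL))).comap (LinearMap.inr ℚ VK VL) := by
        rw [Submodule.span_le]
        intro y hy
        exact Submodule.subset_span ((hGL y).2 hy)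
      rw [hspanL] at this
      exact this trivial
    rw [eq_top_iff]
    rintro ⟨x, y⟩ -
    have := Submodule.add_mem _ (h1 x) (h2 y)
    simpa using this
  · apply le_antisymm
    · rintro ⟨a, b⟩ hab
      have ha : a ∈ dualLattice ΦK K := by
        intro y hy
        have := hab _ ((hGK y).2 hy)
        simpa [auxForm_apply] using this
      obtain ⟨b', hb'⟩ := Submodule.Quotient.mk_surjective _ (f (Submodule.Quotient.mk ⟨a, ha⟩))
      have hG' : (a, (b' : VL)) ∈ G := ⟨⟨a, ha⟩, b', hb'.symm, rfl⟩
      have hG'd : (a, (b' : VL)) ∈ dualLattice (auxForm ΦK ΦL) G := fun y hy => hint _ hG' y hy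
      have hd := Submodule.sub_mem _ hab hG'd
      have hc : b - b' ∈ L := by
        refine hddL.le ?_
        intro y hy
        obtain ⟨x, hx⟩ := Submodule.Quotient.mk_surjective _
          (f.symm (Submodule.Quotient.mk ⟨y, hy⟩))
        have hxy : ((x : VK), y) ∈ G := ⟨x, ⟨y, hy⟩, by rw [hx, f.apply_symm_apply], rfl⟩
        have := hd _ hxy
        simpa [auxForm_apply] using this
      have := G.add_mem hG' ((hGL _).2 hc)
      simpa using this
    · exact fun x hx y hy => hint x hx y hy
  · intro x y
    simp [auxForm_apply]
  · rintro _ ⟨x, hx, rfl⟩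
    exact (hGK x).2 hx
  · rintro ⟨a, b⟩ hx n hn ⟨y, hy, hyx⟩
    have hb : n • b = 0 := (congrArg Prod.snd hyx).symm
    have hb0 : b = 0 := by
      rw [← Int.cast_smul_eq_zsmul ℚ] at hb
      exact (smul_eq_zero.1 hb).resolve_left (by exact_mod_cast hn)
    subst hb0
    exact ⟨a, (hGK a).1 hx, rfl⟩
  · have hperp : ∀ x : VK × VL, x ∈ perpIn (auxForm ΦK ΦL) G
        (K.map ((LinearMap.inl ℚ VK VL).restrictScalars ℤ)) ↔ x.1 = 0 ∧ x.2 ∈ L := by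
      rintro ⟨a, b⟩
      constructor
      · rintro ⟨hG, hp⟩
        have ha : a = 0 := by
          apply hndK
          have : ΦK a = 0 := by
            apply LinearMap.ext_on hspanK
            intro y hy
            have := hp _ ⟨y, hy, rfl⟩
            simpa [auxForm_apply] using this
          intro y; rw [this]; rfl
        subst ha
        exact ⟨rfl, (hGL b).1 hG⟩
      · rintro ⟨ha, hb⟩
        have ha : a = 0 := ha
        subst ha
        refine ⟨(hGL b).2 hb, ?_⟩
        rintro _ ⟨y, hy, rfl⟩
        simp [auxForm_apply]
    refine ⟨
      { toFun := fun x => ⟨(x : VK × VL).2, ((hperp x).1 x.2).2⟩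
        invFun := fun y => ⟨(0, y), (hperp _).2 ⟨rfl, y.2⟩⟩
        left_inv := fun x => Subtype.ext (Prod.ext ((hperp x).1 x.2).1.symm rfl)
        right_inv := fun y => rfl
        map_add' := fun x y => rfl }, ?_⟩
    intro x y
    rw [auxForm_apply, ((hperp x).1 x.2).1]
    simp

theorem stmt_6 {VK VL : Type*} [AddCommGroup VK] [Module ℚ VK] [FiniteDimensional ℚ VK]
    [AddCommGroup VL] [Module ℚ VL] [FiniteDimensional ℚ VL]
    (ΦK : VK →ₗ[ℚ] VK →ₗ[ℚ] ℚ) (ΦL : VL →ₗ[ℚ] VL →ₗ[ℚ] ℚ)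
    (hsymmK : ∀ x y, ΦK x y = ΦK y x) (hsymmL : ∀ x y, ΦL x y = ΦL y x)
    (hndK : ∀ x : VK, (∀ y, ΦK x y = 0) → x = 0)
    (hndL : ∀ x : VL, (∀ y, ΦL x y = 0) → x = 0)
    (K : Submodule ℤ VK) (hfgK : K.FG)
    (hspanK : Submodule.span ℚ (K : Set VK) = ⊤)
    (hintK : ∀ x ∈ K, ∀ y ∈ K, ∃ n : ℤ, ΦK x y = (n : ℚ))
    (hevenK : ∀ x ∈ K, ∃ n : ℤ, ΦK x x = 2 * (n : ℚ))
    (L : Submodule ℤ VL) (hfgL : L.FG)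
    (hspanL : Submodule.span ℚ (L : Set VL) = ⊤)
    (hintL : ∀ x ∈ L, ∀ y ∈ L, ∃ n : ℤ, ΦL x y = (n : ℚ))
    (hevenL : ∀ x ∈ L, ∃ n : ℤ, ΦL x x = 2 * (n : ℚ)) :
    (∃ (ΦG : (VK × VL) →ₗ[ℚ] (VK × VL) →ₗ[ℚ] ℚ) (G : Submodule ℤ (VK × VL))
        (j : VK →ₗ[ℚ] VK × VL),
      (∀ x y, ΦG x y = ΦG y x) ∧ G.FG ∧
      Submodule.span ℚ (G : Set (VK × VL)) = ⊤ ∧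
      (∀ x ∈ G, ∀ y ∈ G, ∃ n : ℤ, ΦG x y = (n : ℚ)) ∧
      (∀ x ∈ G, ∃ n : ℤ, ΦG x x = 2 * (n : ℚ)) ∧
      dualLattice ΦG G = G ∧
      Function.Injective j ∧
      (∀ x y : VK, ΦG (j x) (j y) = ΦK x y) ∧
      K.map (j.restrictScalars ℤ) ≤ G ∧
      (∀ x ∈ G, ∀ n : ℤ, n ≠ 0 → n • x ∈ K.map (j.restrictScalars ℤ) →
        x ∈ K.map (j.restrictScalars ℤ)) ∧
      ∃ e : ↥(perpIn ΦG G (K.map (j.restrictScalars ℤ))) ≃+ ↥L,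
        ∀ x y : ↥(perpIn ΦG G (K.map (j.restrictScalars ℤ))),
          ΦL (e x : VL) (e y : VL) = ΦG (x : VK × VL) (y : VK × VL)) ↔
    (∃ f : discGroup ΦK K ≃+ discGroup ΦL L,
      ∀ (x : ↥(dualLattice ΦK K)) (y : ↥(dualLattice ΦL L)),
        f (Submodule.Quotient.mk x) = Submodule.Quotient.mk y →
        ∃ n : ℤ, ΦL (y : VL) (y : VL) + ΦK (x : VK) (x : VK) = 2 * (n : ℚ)) := by
  constructor
  · rintro ⟨ΦG, G, j, hs, hfg, hspan, hint, heven, hdual, hj, hjΦ, hKG, hprim, e, he⟩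
    obtain ⟨i, hi⟩ := aux_extend L hfgL hspanL
      ((AddSubgroupClass.subtype (perpIn ΦG G (K.map (j.restrictScalars ℤ)))).comp
        (e.symm : L →+ _))
    have hi : ∀ x : L, i x = (e.symm x : VK × VL) := hi
    have hii : ∀ x y, ΦG (i x) (i y) = ΦL x y := by
      have : ΦG.compl₁₂ i i = ΦL := by
        apply aux_ext _ _ _ _ hspanL hspanL
        intro x hx y hy
        rw [LinearMap.compl₁₂_apply, hi ⟨x, hx⟩, hi ⟨y, hy⟩, ← he]
        simp
      intro x y
      rw [← this]; rfl
    have hij : ∀ x y, ΦG (i x) (j y) = 0 := by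
      have : ΦG.compl₁₂ i j = 0 := by
        apply aux_ext _ _ _ _ hspanL hspanK
        intro x hx y hy
        rw [LinearMap.compl₁₂_apply, hi ⟨x, hx⟩]
        exact (e.symm ⟨x, hx⟩).2.2 _ ⟨y, hy, rfl⟩
      intro x y
      have := LinearMap.congr_fun₂ this x y
      simpa using this
    set T : (VK × VL) →ₗ[ℚ] (VK × VL) := j.coprod i with hT
    have hTΦ : ∀ z w, ΦG (T z) (T w) = auxForm ΦK ΦL z w := by
      intro z w
      simp only [hT, LinearMap.coprod_apply, map_add, LinearMap.add_apply, hii, hij, hjΦ,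
        auxForm_apply]
      rw [hs (j z.1), hij]
      ring
    have hTinj : Function.Injective T := by
      rw [injective_iff_map_eq_zero]
      intro z hz
      have h0 : ∀ w, auxForm ΦK ΦL z w = 0 := by
        intro w; rw [← hTΦ, hz]; simp
      ext
      · apply hndK
        intro y
        simpa [auxForm_apply] using h0 (y, 0)
      · apply hndL
        intro y
        simpa [auxForm_apply] using h0 (0, y)
    have hTK : ∀ x, T (x, 0) = j x := by intro x; simp [hT]
    have hTL : ∀ x, T (0, x) = i x := by intro x; simp [hT]
    let E := LinearEquiv.ofInjectiveEndo T hTinj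
    have hE : ∀ x, T (E.symm x) = x := fun x => E.apply_symm_apply x
    refine aux_forward ΦK ΦL hsymmK hsymmL hndK hndL K hspanK L hspanL
      (G.comap (T.restrictScalars ℤ)) ?_ ?_ ?_ ?_ ?_
    · have : G.comap (T.restrictScalars ℤ) = G.map ((E.symm : _ →ₗ[ℚ] _).restrictScalars ℤ) := by
        ext x
        constructor
        · intro hx
          exact ⟨T x, hx, E.symm_apply_apply x⟩
        · rintro ⟨y, hy, rfl⟩
          change T (E.symm y) ∈ G
          rwa [hE]
      rw [this]
      exact hfg.map _
    · intro x hx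
      rw [← hTΦ]
      exact heven _ hx
    · ext x
      have : x ∈ G.comap (T.restrictScalars ℤ) ↔ T x ∈ dualLattice ΦG G := by rw [hdual]; rfl
      rw [this]
      constructor
      · intro h y hy
        have := h (E.symm y) (by change T (E.symm y) ∈ G; rwa [hE])
        rwa [← hTΦ, hE] at this
      · intro h y hy
        rw [← hTΦ]
        exact h _ hy
    · intro x
      change T (x, 0) ∈ G ↔ _
      rw [hTK]
      constructor
      · intro h
        obtain ⟨n, hn, hx⟩ := aux_clear K hspanK x
        obtain ⟨y, hy, hyx⟩ := hprim _ h n hn ⟨n • x, hx, map_zsmul j n x⟩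
        rwa [← hj hyx]
      · intro h
        exact hKG ⟨x, h, rfl⟩
    · intro x
      change T (0, x) ∈ G ↔ _
      rw [hTL]
      constructor
      · intro h
        have hp : i x ∈ perpIn ΦG G (K.map (j.restrictScalars ℤ)) := by
          refine ⟨h, ?_⟩
          rintro _ ⟨y, hy, rfl⟩
          exact hij x y
        have h1 := hi (e ⟨i x, hp⟩)
        rw [e.symm_apply_apply, ← hTL] at h1
        have h2 := congrArg Prod.snd (hTinj (h1.trans (hTL x).symm))
        have h3 : (e ⟨i x, hp⟩ : VL) = x := h2
        rw [← h3]
        exact (e ⟨i x, hp⟩).2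
      · intro h
        rw [hi ⟨x, h⟩]
        exact (e.symm ⟨x, h⟩).2.1
  · rintro ⟨f, hf⟩
    exact aux_backward ΦK ΦL hsymmK hsymmL hndK hndL K hfgK hspanK hintK L hfgL hspanL hintL f hf
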